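/- Let 𝐒 = {S_1, …, S_m} be a set of nonempty finite sets of squarefree positive integers, let Π = ⋃{π(z) : z ∈ ⋃_i S_i}, 𝒮_i = {π(z) : z ∈ S_i}, n = |Π|, and let d be the dimension of the linear span of v((⋃_i 𝒮_i) \ {∅}) in Fⁿ, where F is the field of 2 elements. Let M_0 = {i : 1 ∉ S_i}, M_1 = {i : 1 ∈ S_i}, and 𝒩(M_0, M_1) = {N ⊆ Π : |N ∩ S| is even for all S ∈ ⋃_{i∈M_1} 𝒮_i and |N ∩ S| is odd for all S ∈ ⋃_{i∈M_0} 𝒮_i}. For each i let X_i^+ (respectively X_i^−) be the set of allowable primes p such that χ_p is identically 1 (respectively identically −1) on S_i. Then the density of (⋂_{i∈M_1} X_i^+) ∩ (⋂_{i∈M_0} X_i^−) equals 2^{−d} if 𝒩(M_0, M_1) ≠ ∅, and equals 0 otherwise. -/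

import Mathlib

open scoped Classical

/-- The density of a set `P` of primes within the set of all primes. -/
def HasPrimeDensity (P : Set ℕ) (δ : ℝ) : Prop :=
  Filter.Tendsto
    (fun x : ℕ => (({p ∈ P | p ≤ x}.ncard : ℝ) / ({p | Nat.Prime p ∧ p ≤ x}.ncard : ℝ)))
    Filter.atTop (nhds δ)

/-- For a finite set `A` of naturals with `A.card = n`, listing the elements of `A` in
increasing order, `indVec A h S` is the indicator vector in `F^n` (over the field `F` of two
elements) of the subset `S ⊆ A`. -/
noncomputable def indVec {n : ℕ} (A : Finset ℕ) (h : A.card = n) (S : Finset ℕ) :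
    Fin n → ZMod 2 :=
  fun i => if (↑(A.orderIsoOfFin h i) : ℕ) ∈ S then 1 else 0

/-- `NSet S P0 X Y` is the collection of subsets `N` of the ground set `P0 = Π` such that
`|N ∩ π(z)|` is even for every `z ∈ S i` with `i ∈ X`, and odd for every `z ∈ S i` with
`i ∈ Y` (equivalently, the parity conditions hold for every member of `⋃_{i∈X} 𝒮_i`, resp.
`⋃_{i∈Y} 𝒮_i`, where `𝒮_i = {π(z) : z ∈ S i}`). -/
noncomputable def NSet {m : ℕ} (S : Fin m → Finset ℕ) (P0 : Finset ℕ)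
    (X Y : Finset (Fin m)) : Finset (Finset ℕ) :=
  P0.powerset.filter (fun N =>
    (∀ i ∈ X, ∀ z ∈ S i, Even (N ∩ z.primeFactors).card) ∧
    (∀ i ∈ Y, ∀ z ∈ S i, Odd (N ∩ z.primeFactors).card))

section
open MeasureTheory Filter Topology FourierTransform Convolution

/-- A nonnegative integrable kernel of total mass one whose Fourier transform has compact support. -/
structure IsBandLimitedKernel (K : ℝ → ℝ) : Prop where
  nonneg : ∀ u, 0 ≤ K u
  continuous : Continuous K
  integrable : Integrable K
  integral_eq_one : ∫ u, K u = 1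
  exists_fourier_eq : ∃ w : ℝ → ℂ, Continuous w ∧ HasCompactSupport w ∧ ∀ u, 𝓕 w u = (K u : ℂ)

lemma exists_isBandLimitedKernel : ∃ K, IsBandLimitedKernel K := by
  let b : ContDiffBump (0 : ℝ) := default
  let f : ℝ → ℂ := fun x => (b x : ℂ)
  have hfc : HasCompactSupport f := b.hasCompactSupport.comp_left (g := fun x : ℝ => (x : ℂ)) rfl
  have hfd : ContDiff ℝ ((⊤ : ℕ∞) : WithTop ℕ∞) f := Complex.ofRealCLM.contDiff.comp b.contDiff
  let g : SchwartzMap ℝ ℂ := hfc.toSchwartzMap hfd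
  have hgf : (g : ℝ → ℂ) = f := rfl
  have hfi : Integrable f := hgf ▸ g.integrable
  have hF : 𝓕 f = ((𝓕 g : SchwartzMap ℝ ℂ) : ℝ → ℂ) := by rw [SchwartzMap.fourier_coe, hgf]
  have hreal (u : ℝ) : (starRingEnd ℂ) (𝓕 f u) = 𝓕 f u := by
    rw [Real.fourier_eq' , ← integral_conj, ← integral_neg_eq_self]
    refine integral_congr_ae (.of_forall fun x => ?_)
    simp [f, b.neg, ← Complex.exp_conj, Complex.conj_ofNat]
  let k : ℝ → ℝ := fun u => (𝓕 f u).re ^ 2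
  have hk (u : ℝ) : ((k u : ℝ) : ℂ) = 𝓕 f u * 𝓕 f u := by
    have := Complex.conj_eq_iff_re.1 (hreal u)
    rw [show k u = (𝓕 f u).re * (𝓕 f u).re from sq _, Complex.ofReal_mul, this]
  have hkcont : Continuous k := by
    simp only [k, hF]
    fun_prop
  have hkint : Integrable k := by
    have h1 := (SchwartzMap.pairing (ContinuousLinearMap.mul ℂ ℂ) (𝓕 g) (𝓕 g)).integrable (μ := volume)
    have h2 : (fun u => ((k u : ℝ) : ℂ)) = SchwartzMap.pairing (ContinuousLinearMap.mul ℂ ℂ) (𝓕 g) (𝓕 g) := by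
      ext u
      simp [hk, hF]
    rw [← h2] at h1
    exact h1.re
  have hk0 : k 0 ≠ 0 := by
    have : 𝓕 f 0 = ((∫ x, b x : ℝ) : ℂ) := by
      rw [Real.fourier_eq']
      simp [f, integral_complex_ofReal]
    simp only [k, this, Complex.ofReal_re]
    exact (pow_pos b.integral_pos 2).ne'
  have hpos : 0 < ∫ u, k u :=
    integral_pos_of_integrable_nonneg_nonzero hkcont hkint (fun u => sq_nonneg _) hk0
  obtain ⟨c, hc⟩ : ∃ c, c = ∫ u, k u := ⟨_, rfl⟩
  rw [← hc] at hpos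
  refine ⟨fun u => c⁻¹ * k u, fun u => mul_nonneg (inv_nonneg.2 hpos.le) (sq_nonneg _),
    continuous_const.mul hkcont, hkint.const_mul _, ?_,
    fun x => (c⁻¹ : ℂ) * (f ⋆[ContinuousLinearMap.mul ℂ ℂ] f) x, ?_, ?_, ?_⟩
  · rw [integral_const_mul, ← hc, inv_mul_cancel₀ hpos.ne']
  · have : Continuous (f ⋆[ContinuousLinearMap.mul ℂ ℂ] f) :=
      hfc.continuous_convolution_right _ hfi.locallyIntegrable hfd.continuous
    exact continuous_const.mul this
  · have : HasCompactSupport (f ⋆[ContinuousLinearMap.mul ℂ ℂ] f) := hfc.convolution _ hfc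
    exact this.mul_left
  · intro u
    have := Real.fourier_mul_convolution_eq hfi hfi u
    rw [Real.fourier_eq] at this ⊢
    simp only [Circle.smul_def, smul_eq_mul] at this ⊢
    simp_rw [mul_left_comm _ (c⁻¹ : ℂ)]
    rw [integral_const_mul, this, Complex.ofReal_mul, hk, Complex.ofReal_inv]

lemma IsBandLimitedKernel.rescale {K : ℝ → ℝ} (hK : IsBandLimitedKernel K) {r : ℝ} (hr : 0 < r) :
    IsBandLimitedKernel (fun u => r * K (r * u)) := by
  obtain ⟨h0, hc, hi, h1, w, hwc, hws, hw⟩ := hK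
  refine ⟨fun u => mul_nonneg hr.le (h0 _), by fun_prop,
    (hi.comp_mul_left' hr.ne').const_mul _, ?_, fun x => w (r⁻¹ * x), by fun_prop, ?_, ?_⟩
  · rw [integral_const_mul, Measure.integral_comp_mul_left, h1, abs_of_pos (by positivity)]
    simp [hr.ne']
  · exact hws.comp_homeomorph (Homeomorph.mulLeft₀ r⁻¹ (by positivity))
  · intro u
    have := hw (r * u)
    rw [Real.fourier_real_eq_integral_exp_smul] at this ⊢
    have h := Measure.integral_comp_mul_left
      (fun x => Complex.exp (↑(-2 * Real.pi * x * (r * u)) * Complex.I) • w x) r⁻¹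
    rw [this, inv_inv, abs_of_pos hr] at h
    rw [Complex.ofReal_mul, ← Complex.real_smul, ← h]
    refine integral_congr_ae (.of_forall fun x => ?_)
    simp only
    congr 4
    field_simp

lemma exists_isBandLimitedKernel_concentrated {δ η : ℝ} (hδ : 0 < δ) (hη : η < 1) :
    ∃ K, IsBandLimitedKernel K ∧ η < ∫ u in Set.Icc (-δ) δ, K u := by
  obtain ⟨K, hK⟩ := exists_isBandLimitedKernel
  have hlim : Tendsto (fun r : ℝ => ∫ u in (-r)..r, K u) atTop (𝓝 1) := by
    rw [← hK.integral_eq_one]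
    exact intervalIntegral_tendsto_integral hK.integrable tendsto_neg_atTop_atBot tendsto_id
  obtain ⟨r, hr, hr0⟩ := ((hlim.eventually_const_lt hη).and (eventually_gt_atTop 0)).exists
  refine ⟨_, hK.rescale (r := r / δ) (by positivity), ?_⟩
  rw [integral_Icc_eq_integral_Ioc, ← intervalIntegral.integral_of_le (by linarith),
    intervalIntegral.integral_const_mul, intervalIntegral.mul_integral_comp_mul_left]
  rw [div_mul_cancel₀ _ hδ.ne', mul_neg, div_mul_cancel₀ _ hδ.ne']
  exact hr
section
open Set

variable {B : ℝ → ℝ} {C : ℝ} {K : ℝ → ℝ}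

lemma integrable_indicator_mul_exp (hBm : Measurable B) (hB : ∀ u, |B u| ≤ C) {σ : ℝ}
    (hσ : 0 < σ) : Integrable ((Ioi 0).indicator fun u => ((B u * Real.exp (-σ * u) : ℝ) : ℂ)) := by
  rw [integrable_indicator_iff measurableSet_Ioi]
  refine (Integrable.bdd_mul (c := C) (exp_neg_integrableOn_Ioi 0 hσ)
    hBm.aestronglyMeasurable (.of_forall hB)).ofReal

lemma fourier_indicator_mul_exp {g : ℂ → ℂ} {σ : ℝ}
    (hBg : ∀ s : ℂ, 0 < s.re → ∫ u in Ioi 0, (B u : ℂ) * Complex.exp (-s * u) = g s)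
    (hσ : 0 < σ) (ξ : ℝ) :
    𝓕 ((Ioi 0).indicator fun u => ((B u * Real.exp (-σ * u) : ℝ) : ℂ)) ξ =
      g (σ + 2 * Real.pi * ξ * Complex.I) := by
  rw [← hBg _ (by simpa using hσ), Real.fourier_real_eq_integral_exp_smul, ← integral_indicator measurableSet_Ioi]
  refine integral_congr_ae (.of_forall fun u => ?_)
  simp only [indicator_apply, smul_eq_mul]
  split_ifs
  · rw [mul_comm, Complex.ofReal_mul, Complex.ofReal_exp, mul_assoc, ← Complex.exp_add]
    congr 2
    push_cast
    ring
  · simp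

lemma integral_mul_exp_mul_kernel {g : ℂ → ℂ} (hBm : Measurable B) (hB : ∀ u, |B u| ≤ C)
    (hBg : ∀ s : ℂ, 0 < s.re → ∫ u in Ioi 0, (B u : ℂ) * Complex.exp (-s * u) = g s)
    {w : ℝ → ℂ} (hwc : Continuous w) (hws : HasCompactSupport w) (hw : ∀ u, 𝓕 w u = (K u : ℂ))
    {σ : ℝ} (hσ : 0 < σ) (v : ℝ) :
    ∫ ξ : ℝ, g (σ + 2 * Real.pi * ξ * Complex.I) *
        (Complex.exp ((2 * Real.pi * v * ξ : ℝ) * Complex.I) * w ξ) =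
      ∫ u in Ioi 0, ((B u * Real.exp (-σ * u) * K (u - v) : ℝ) : ℂ) := by
  have hwi : Integrable fun ξ : ℝ => Complex.exp ((2 * Real.pi * v * ξ : ℝ) * Complex.I) * w ξ :=
    (Continuous.mul (by fun_prop) hwc).integrable_of_hasCompactSupport hws.mul_left
  have hshift (u : ℝ) : 𝓕 (fun ξ : ℝ => Complex.exp ((2 * Real.pi * v * ξ : ℝ) * Complex.I) * w ξ) u
      = (K (u - v) : ℂ) := by
    rw [← hw, Real.fourier_real_eq_integral_exp_smul, Real.fourier_real_eq_integral_exp_smul]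
    refine integral_congr_ae (.of_forall fun ξ => ?_)
    simp only [smul_eq_mul]
    rw [← mul_assoc, ← Complex.exp_add]
    congr 2
    push_cast
    ring
  have key := VectorFourier.integral_fourierIntegral_smul_eq_flip (μ := volume) (ν := volume)
    (L := innerₗ ℝ) Real.continuous_fourierChar continuous_inner
    (integrable_indicator_mul_exp hBm hB hσ) hwi
  rw [← integral_indicator measurableSet_Ioi]
  refine Eq.trans (integral_congr_ae (.of_forall fun ξ => ?_))
    (key.trans (integral_congr_ae (.of_forall fun u => ?_)))
  · simp only [smul_eq_mul]
    rw [← fourier_indicator_mul_exp hBg hσ]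
    rfl
  · simp only [flip_innerₗ, smul_eq_mul]
    refine Eq.trans (congrArg _ (hshift u)) ?_
    simp only [indicator_apply]
    split_ifs <;> simp

lemma tendsto_integral_mul_kernel_zero {g : ℂ → ℂ} (hBm : Measurable B) (hB : ∀ u, |B u| ≤ C)
    (hg : ContinuousOn g {s | 0 ≤ s.re})
    (hBg : ∀ s : ℂ, 0 < s.re → ∫ u in Ioi 0, (B u : ℂ) * Complex.exp (-s * u) = g s)
    (hK : IsBandLimitedKernel K) :
    Tendsto (fun v => ∫ u in Ioi 0, B u * K (u - v)) atTop (𝓝 0) := by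
  obtain ⟨w, hwc, hws, hw⟩ := hK.exists_fourier_eq
  have hKv (v : ℝ) : Integrable fun u => K (u - v) := hK.integrable.comp_sub_right v
  have hlim (v : ℝ) : ∫ ξ : ℝ, g (2 * Real.pi * ξ * Complex.I) *
        (Complex.exp ((2 * Real.pi * v * ξ : ℝ) * Complex.I) * w ξ) =
      ((∫ u in Ioi 0, B u * K (u - v) : ℝ) : ℂ) := by
    rw [← integral_complex_ofReal]
    have hR : Tendsto (fun σ : ℝ => ∫ u in Ioi 0, ((B u * Real.exp (-σ * u) * K (u - v) : ℝ) : ℂ))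
        (𝓝[>] 0) (𝓝 (∫ u in Ioi 0, ((B u * K (u - v) : ℝ) : ℂ))) := by
      refine tendsto_integral_filter_of_dominated_convergence (fun u => C * K (u - v)) ?_ ?_ ?_ ?_
      · refine .of_forall fun σ => Measurable.aestronglyMeasurable ?_
        have := hK.continuous.measurable
        fun_prop
      · filter_upwards [self_mem_nhdsWithin] with σ hσ
        filter_upwards [ae_restrict_mem measurableSet_Ioi] with u hu
        rw [Complex.norm_real, Real.norm_eq_abs, abs_mul, abs_mul, abs_of_nonneg (hK.nonneg _)]
        refine mul_le_mul_of_nonneg_right ?_ (hK.nonneg _)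
        refine (mul_le_of_le_one_right (abs_nonneg _) ?_).trans (hB u)
        rw [Real.abs_exp, Real.exp_le_one_iff]
        have : 0 < σ * u := mul_pos hσ hu
        linarith
      · exact ((hKv v).const_mul C).integrableOn
      · refine .of_forall fun u => tendsto_nhdsWithin_of_tendsto_nhds ?_
        have : Continuous fun σ : ℝ => ((B u * Real.exp (-σ * u) * K (u - v) : ℝ) : ℂ) := by fun_prop
        simpa using this.tendsto 0
    refine tendsto_nhds_unique (f := fun σ : ℝ => ∫ ξ : ℝ, g (σ + 2 * Real.pi * ξ * Complex.I) *
        (Complex.exp ((2 * Real.pi * v * ξ : ℝ) * Complex.I) * w ξ)) ?_ (hR.congr' ?_)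
    · have hcont : ContinuousOn (Function.uncurry fun σ ξ : ℝ =>
          g (σ + 2 * Real.pi * ξ * Complex.I) *
            (Complex.exp ((2 * Real.pi * v * ξ : ℝ) * Complex.I) * w ξ)) (Ici 0 ×ˢ univ) := by
        simp only [Function.uncurry_def]
        refine ContinuousOn.mul (hg.comp (by fun_prop) ?_) (by fun_prop)
        rintro ⟨σ, ξ⟩ ⟨h, -⟩
        simpa using h
      have := continuousOn_integral_of_compact_support (μ := volume) hws.isCompact hcont ?_
      · simpa using ((this 0 self_mem_Ici).mono Ioi_subset_Ici_self).tendsto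
      · intro σ ξ _ hξ
        simp [image_eq_zero_of_notMem_tsupport hξ]
    · filter_upwards [self_mem_nhdsWithin] with σ hσ
      exact (integral_mul_exp_mul_kernel hBm hB hBg hwc hws hw hσ v).symm
  have hRL := (Real.zero_at_infty_fourier fun ξ : ℝ => g (2 * Real.pi * ξ * Complex.I) * w ξ).comp
    (tendsto_neg_atTop_atBot.mono_right atBot_le_cocompact)
  have : Tendsto (fun v => ((∫ u in Ioi 0, B u * K (u - v) : ℝ) : ℂ)) atTop (𝓝 0) := by
    refine hRL.congr fun v => ?_
    rw [← hlim, Function.comp_apply, Real.fourier_real_eq_integral_exp_smul]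
    refine integral_congr_ae (.of_forall fun ξ => ?_)
    simp only [smul_eq_mul]
    rw [mul_left_comm]
    congr 4
    push_cast
    ring
  exact tendsto_ofReal_iff.1 (by simpa only [Complex.ofReal_zero] using this)

end

section
open Set

variable {K : ℝ → ℝ}

lemma IsBandLimitedKernel.tendsto_integral_Ioi (hK : IsBandLimitedKernel K) :
    Tendsto (fun v => ∫ u in Ioi 0, K (u - v)) atTop (𝓝 1) := by
  have h (v : ℝ) : ∫ u in Ioi 0, K (u - v) = ∫ u, (Ioi (-v)).indicator K u := by
    rw [← integral_indicator measurableSet_Ioi,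
      ← integral_sub_right_eq_self (fun u => (Ioi (-v)).indicator K u) v]
    simp [indicator_apply]
  simp_rw [h]
  rw [← hK.integral_eq_one]
  refine tendsto_integral_filter_of_dominated_convergence K ?_ ?_ hK.integrable ?_
  · exact .of_forall fun v => hK.integrable.aestronglyMeasurable.indicator measurableSet_Ioi
  · refine .of_forall fun v => .of_forall fun u => (norm_indicator_le_norm_self _ _).trans ?_
    rw [Real.norm_of_nonneg (hK.nonneg u)]
  · refine .of_forall fun u => tendsto_const_nhds.congr' ?_
    filter_upwards [eventually_gt_atTop (-u)] with v hv
    rw [indicator_of_mem]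
    rw [mem_Ioi]
    linarith

lemma IsBandLimitedKernel.setIntegral_comp_sub (v δ : ℝ) (hδ : 0 < δ) :
    ∫ u in Icc (v - δ) (v + δ), K (u - v) = ∫ u in Icc (-δ) δ, K u := by
  rw [integral_Icc_eq_integral_Ioc, integral_Icc_eq_integral_Ioc,
    ← intervalIntegral.integral_of_le (by linarith), ← intervalIntegral.integral_of_le (by linarith),
    intervalIntegral.integral_comp_sub_right]
  congr 1 <;> ring

variable {B : ℝ → ℝ} {C : ℝ}

lemma IsBandLimitedKernel.integrable_mul_comp_sub (hK : IsBandLimitedKernel K) (hBm : Measurable B)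
    (hB : ∀ u, |B u| ≤ C) (v : ℝ) : Integrable fun u => B u * K (u - v) :=
  (hK.integrable.comp_sub_right v).bdd_mul (c := C) hBm.aestronglyMeasurable (.of_forall hB)

lemma le_exp_mul_integral_mul_kernel (hK : IsBandLimitedKernel K) (hBm : Measurable B)
    (hB0 : ∀ u, 0 ≤ B u) (hB : ∀ u, |B u| ≤ C) (hmono : Monotone fun u => B u * Real.exp u)
    {δ : ℝ} (hδ : 0 < δ) (hKδ : Real.exp (-δ) < ∫ u in Icc (-δ) δ, K u) {v : ℝ} (hv : 0 < v) :
    B v ≤ Real.exp (3 * δ) * ∫ u in Ioi 0, B u * K (u - (v + δ)) := by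
  have hint := hK.integrable_mul_comp_sub hBm hB (v + δ)
  have h1 : ∫ u in Icc ((v + δ) - δ) ((v + δ) + δ), B v * Real.exp (-(2 * δ)) * K (u - (v + δ)) ≤
      ∫ u in Ioi 0, B u * K (u - (v + δ)) := by
    refine le_trans (setIntegral_mono_on ((hK.integrable.comp_sub_right _).const_mul _).integrableOn
      hint.integrableOn measurableSet_Icc fun u hu => ?_) (setIntegral_mono_set hint.integrableOn
      (.of_forall fun u => mul_nonneg (hB0 u) (hK.nonneg _)) (LE.le.eventuallyLE ?_))
    · refine mul_le_mul_of_nonneg_right ?_ (hK.nonneg _)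
      have h2 := hmono (show v ≤ u by linarith [hu.1])
      simp only at h2
      calc B v * Real.exp (-(2 * δ)) ≤ B v * Real.exp (v - u) := by
            gcongr
            · exact hB0 v
            · linarith [hu.2]
        _ = (B v * Real.exp v) * Real.exp (-u) := by rw [mul_assoc, ← Real.exp_add, sub_eq_add_neg]
        _ ≤ (B u * Real.exp u) * Real.exp (-u) := by gcongr
        _ = B u := by rw [mul_assoc, ← Real.exp_add]; simp
    · intro u hu
      rw [mem_Ioi]
      linarith [hu.1]
  rw [integral_const_mul, IsBandLimitedKernel.setIntegral_comp_sub _ _ hδ] at h1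
  calc B v = Real.exp (3 * δ) * (B v * Real.exp (-(2 * δ)) * Real.exp (-δ)) := by
        rw [mul_assoc, ← Real.exp_add, mul_left_comm, ← Real.exp_add]
        ring_nf
        simp
    _ ≤ Real.exp (3 * δ) * (B v * Real.exp (-(2 * δ)) * ∫ u in Icc (-δ) δ, K u) := by
        have := hB0 v
        gcongr
    _ ≤ _ := by gcongr

lemma integral_mul_kernel_le_exp_mul_add (hK : IsBandLimitedKernel K) (hBm : Measurable B)
    (hB0 : ∀ u, 0 ≤ B u) (hB : ∀ u, |B u| ≤ C) (hmono : Monotone fun u => B u * Real.exp u)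
    {δ : ℝ} (hδ : 0 < δ) (hKδ : Real.exp (-δ) < ∫ u in Icc (-δ) δ, K u) (v : ℝ) :
    ∫ u in Ioi 0, B u * K (u - (v - δ)) ≤ Real.exp (2 * δ) * B v + C * δ := by
  have hC : 0 ≤ C := (abs_nonneg _).trans (hB 0)
  have hint := hK.integrable_mul_comp_sub hBm hB (v - δ)
  have hKi : Integrable fun u => K (u - (v - δ)) := hK.integrable.comp_sub_right _
  set S := Icc ((v - δ) - δ) ((v - δ) + δ)
  set κ := ∫ u in Icc (-δ) δ, K u
  have hκ : κ ≤ 1 := by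
    rw [← hK.integral_eq_one]
    exact setIntegral_le_integral hK.integrable (.of_forall hK.nonneg)
  have hS : ∫ u in S, K (u - (v - δ)) = κ := IsBandLimitedKernel.setIntegral_comp_sub _ _ hδ
  have hSc : ∫ u in Sᶜ, K (u - (v - δ)) = 1 - κ := by
    rw [setIntegral_compl measurableSet_Icc hKi, hS, integral_sub_right_eq_self, hK.integral_eq_one]
  calc ∫ u in Ioi 0, B u * K (u - (v - δ)) ≤ ∫ u, B u * K (u - (v - δ)) :=
        setIntegral_le_integral hint (.of_forall fun u => mul_nonneg (hB0 u) (hK.nonneg _))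
    _ = (∫ u in S, B u * K (u - (v - δ))) + ∫ u in Sᶜ, B u * K (u - (v - δ)) :=
        (integral_add_compl measurableSet_Icc hint).symm
    _ ≤ (∫ u in S, (Real.exp (2 * δ) * B v) * K (u - (v - δ))) +
          ∫ u in Sᶜ, C * K (u - (v - δ)) := by
        refine add_le_add (setIntegral_mono_on hint.integrableOn (hKi.const_mul _).integrableOn
          measurableSet_Icc fun u hu => ?_) (setIntegral_mono hint.integrableOn
          (hKi.const_mul _).integrableOn fun u => ?_)
        · refine mul_le_mul_of_nonneg_right ?_ (hK.nonneg _)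
          have h2 := hmono (show u ≤ v by linarith [hu.2])
          simp only at h2
          calc B u = (B u * Real.exp u) * Real.exp (-u) := by rw [mul_assoc, ← Real.exp_add]; simp
            _ ≤ (B v * Real.exp v) * Real.exp (-u) := by gcongr
            _ = Real.exp (v - u) * B v := by
                rw [mul_assoc, ← Real.exp_add, sub_eq_add_neg, mul_comm]
            _ ≤ Real.exp (2 * δ) * B v := by
                have := hB0 v
                gcongr
                linarith [hu.1]
        · exact mul_le_mul_of_nonneg_right ((le_abs_self _).trans (hB u)) (hK.nonneg _)
    _ = Real.exp (2 * δ) * B v * κ + C * (1 - κ) := by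
        rw [integral_const_mul, integral_const_mul, hS, hSc]
    _ ≤ Real.exp (2 * δ) * B v * 1 + C * δ := by
        have := hB0 v
        have := Real.add_one_le_exp (-δ)
        gcongr
        linarith
    _ = _ := by rw [mul_one]

lemma tendsto_of_tendsto_integral_mul_kernel (hBm : Measurable B) (hB0 : ∀ u, 0 ≤ B u)
    (hB : ∀ u, |B u| ≤ C) (hmono : Monotone fun u => B u * Real.exp u) {A : ℝ}
    (hlim : ∀ K, IsBandLimitedKernel K →
      Tendsto (fun v => ∫ u in Ioi 0, B u * K (u - v)) atTop (𝓝 A)) :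
    Tendsto B atTop (𝓝 A) := by
  have hkernel {δ : ℝ} (hδ : 0 < δ) :
      ∃ K, IsBandLimitedKernel K ∧ Real.exp (-δ) < ∫ u in Icc (-δ) δ, K u :=
    exists_isBandLimitedKernel_concentrated hδ (by simpa using hδ)
  refine tendsto_order.2 ⟨fun a ha => ?_, fun a ha => ?_⟩
  · have h : Tendsto (fun δ : ℝ => Real.exp (2 * δ) * a + C * δ) (𝓝[>] 0) (𝓝 a) :=
      tendsto_nhdsWithin_of_tendsto_nhds
        (Continuous.tendsto' (by fun_prop) _ _ (by simp))
    obtain ⟨δ, hδa, hδ⟩ := ((h.eventually_lt_const ha).and self_mem_nhdsWithin).exists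
    replace hδ : 0 < δ := hδ
    obtain ⟨K, hK, hKδ⟩ := hkernel hδ
    have := (hlim K hK).comp (tendsto_atTop_add_const_right atTop (-δ) tendsto_id)
    filter_upwards [this.eventually_const_lt hδa] with v hv
    have h2 := hv.trans_le (integral_mul_kernel_le_exp_mul_add hK hBm hB0 hB hmono hδ hKδ v)
    exact lt_of_mul_lt_mul_left (by linarith) (Real.exp_pos (2 * δ)).le
  · have h : Tendsto (fun δ : ℝ => Real.exp (3 * δ) * A) (𝓝[>] 0) (𝓝 A) :=
      tendsto_nhdsWithin_of_tendsto_nhds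
        (Continuous.tendsto' (by fun_prop) _ _ (by simp))
    obtain ⟨δ, hδa, hδ⟩ := ((h.eventually_lt_const ha).and self_mem_nhdsWithin).exists
    replace hδ : 0 < δ := hδ
    obtain ⟨K, hK, hKδ⟩ := hkernel hδ
    have := ((hlim K hK).comp
      (tendsto_atTop_add_const_right atTop δ tendsto_id)).const_mul (Real.exp (3 * δ))
    filter_upwards [this.eventually_lt_const hδa, eventually_gt_atTop 0] with v hv hv0
    exact (le_exp_mul_integral_mul_kernel hK hBm hB0 hB hmono hδ hKδ hv0).trans_lt hv

end

section
open Set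

lemma integral_sum_mul_exp_eq {a : ℕ → ℝ} (ha : ∀ n, 0 ≤ a n) {C : ℝ}
    (hC : ∀ n, ∑ k ∈ Finset.Icc 1 n, a k ≤ C * n) {s : ℂ} (hs : 0 < s.re) :
    ∫ u in Ioi (0 : ℝ), (((∑ k ∈ Finset.Icc 1 ⌊Real.exp u⌋₊, a k) * Real.exp (-u) : ℝ) : ℂ) *
      Complex.exp (-s * u) = LSeries (fun n => (a n : ℂ)) (1 + s) / (1 + s) := by
  have hO : (fun n : ℕ => ∑ k ∈ Finset.Icc 1 n, a k) =O[atTop] fun n : ℕ => (n : ℝ) ^ (1 : ℝ) := by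
    refine .of_bound C (.of_forall fun n => ?_)
    rw [Real.norm_of_nonneg (Finset.sum_nonneg fun k _ => ha k), Real.rpow_one,
      Real.norm_of_nonneg n.cast_nonneg]
    exact hC n
  have hs1 : (1 + s) ≠ 0 := fun h => by
    have := congrArg Complex.re h
    simp at this
    linarith
  rw [LSeries_eq_mul_integral_of_nonneg a zero_le_one (s := 1 + s) (by simpa using hs) hO ha,
    mul_div_cancel_left₀ _ hs1, ← Real.exp_zero, ← integral_comp_exp_Ioi]
  refine setIntegral_congr_fun measurableSet_Ioi fun u _ => ?_
  simp only [Complex.real_smul]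
  rw [Complex.cpow_def_of_ne_zero (by simp), ← Complex.ofReal_log (Real.exp_pos u).le,
    Real.log_exp, mul_left_comm (Real.exp u : ℂ), Complex.ofReal_exp, ← Complex.exp_add]
  push_cast
  rw [mul_assoc, ← Complex.exp_add]
  congr 2
  ring

/-- The **Wiener-Ikehara theorem**, under an a priori Chebyshev bound on the partial sums. -/
theorem tendsto_sum_div_of_LSeries_eq {a : ℕ → ℝ} (ha : ∀ n, 0 ≤ a n) {C : ℝ}
    (hC : ∀ n, ∑ k ∈ Finset.Icc 1 n, a k ≤ C * n) {A : ℝ} {G : ℂ → ℂ}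
    (hG : ContinuousOn G {s | 1 ≤ s.re})
    (hGL : ∀ s : ℂ, 1 < s.re → LSeries (fun n => (a n : ℂ)) s = G s + A / (s - 1)) :
    Tendsto (fun n : ℕ => (∑ k ∈ Finset.Icc 1 n, a k) / n) atTop (𝓝 A) := by
  set ψ : ℕ → ℝ := fun n => ∑ k ∈ Finset.Icc 1 n, a k
  have hψ : Monotone ψ := fun m n h =>
    Finset.sum_le_sum_of_subset_of_nonneg (Finset.Icc_subset_Icc_right h) fun k _ _ => ha k
  have hψ0 (n : ℕ) : 0 ≤ ψ n := Finset.sum_nonneg fun k _ => ha k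
  have hC0 : 0 ≤ C := by simpa using (hψ0 1).trans (hC 1)
  set B : ℝ → ℝ := fun u => ψ ⌊Real.exp u⌋₊ * Real.exp (-u)
  have hfloor : Monotone fun u => ψ ⌊Real.exp u⌋₊ :=
    fun u v h => hψ (Nat.floor_mono (Real.exp_le_exp.2 h))
  have hBm : Measurable B := hfloor.measurable.mul (by fun_prop)
  have hB0 (u : ℝ) : 0 ≤ B u := mul_nonneg (hψ0 _) (Real.exp_pos _).le
  have hB (u : ℝ) : |B u| ≤ C := by
    rw [abs_of_nonneg (hB0 u)]
    calc B u ≤ C * Real.exp u * Real.exp (-u) := by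
          refine mul_le_mul_of_nonneg_right ((hC _).trans ?_) (Real.exp_pos _).le
          gcongr
          exact Nat.floor_le (Real.exp_pos _).le
      _ = C := by rw [mul_assoc, ← Real.exp_add]; simp
  have hBmono : Monotone fun u => B u * Real.exp u := by
    convert hfloor using 2 with u
    rw [mul_assoc, ← Real.exp_add]
    simp
  have hBA (u : ℝ) : |B u - A| ≤ C + |A| := (abs_sub _ _).trans (by gcongr; exact hB u)
  have hne {s : ℂ} (hs : 0 ≤ s.re) : 1 + s ≠ 0 := fun h => by
    have := congrArg Complex.re h
    simp at this
    linarith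
  have hlim : Tendsto B atTop (𝓝 A) := by
    refine tendsto_of_tendsto_integral_mul_kernel hBm hB0 hB hBmono fun K hK => ?_
    have h0 := tendsto_integral_mul_kernel_zero (g := fun s => (G (1 + s) - A) / (1 + s))
      (hBm.sub_const A) hBA ?_ ?_ hK
    · have h1 := h0.add (hK.tendsto_integral_Ioi.const_mul A)
      rw [zero_add, mul_one] at h1
      refine h1.congr fun v => ?_
      have hi := hK.integrable_mul_comp_sub (hBm.sub_const A) hBA v
      have hi2 := (hK.integrable.comp_sub_right v).const_mul A
      rw [← integral_const_mul, ← integral_add hi.integrableOn hi2.integrableOn]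
      refine integral_congr_ae (.of_forall fun u => ?_)
      simp only
      ring
    · refine ContinuousOn.div ((hG.comp (by fun_prop) ?_).sub continuousOn_const) (by fun_prop)
        fun s hs => hne hs
      intro s hs
      simpa using hs
    · intro s hs
      have hexp : IntegrableOn (fun u : ℝ => Complex.exp (-s * u)) (Ioi 0) :=
        integrableOn_exp_mul_complex_Ioi (by simpa using hs) 0
      have hi : IntegrableOn (fun u : ℝ => (B u : ℂ) * Complex.exp (-s * u)) (Ioi 0) :=
        hexp.bdd_mul (c := C) (by fun_prop) (.of_forall fun u => by simpa using hB u)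
      have hs0 : s ≠ 0 := fun h => by simp [h] at hs
      simp only [Complex.ofReal_sub, sub_mul]
      rw [integral_sub hi (hexp.const_mul _), integral_const_mul,
        integral_sum_mul_exp_eq ha hC hs, integral_exp_mul_complex_Ioi (by simpa using hs),
        hGL _ (by simpa using hs)]
      have := hne hs.le
      simp only [Complex.ofReal_zero, mul_zero, Complex.exp_zero, add_sub_cancel_left]
      field_simp
      ring
  refine ((hlim.comp (Real.tendsto_log_atTop.comp tendsto_natCast_atTop_atTop))).congr' ?_
  filter_upwards [eventually_gt_atTop 0] with n hn
  have hn' : (0 : ℝ) < n := by exact_mod_cast hn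
  simp [B, ψ, Real.exp_neg, Real.exp_log hn', div_eq_mul_inv]

end

section
open ArithmeticFunction.vonMangoldt
open scoped ArithmeticFunction.vonMangoldt

theorem tendsto_sum_residueClass_div {q : ℕ} [NeZero q] {b : ZMod q} (hb : IsUnit b) :
    Tendsto (fun n : ℕ => (∑ k ∈ Finset.Icc 1 n, residueClass b k) / n) atTop
      (𝓝 (q.totient : ℝ)⁻¹) := by
  refine tendsto_sum_div_of_LSeries_eq (residueClass_nonneg b) (C := Real.log 4 + 4)
    (fun n => ?_) (continuousOn_LFunctionResidueClassAux b) fun s hs => ?_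
  · refine le_trans ?_ (Chebyshev.psi_le_const_mul_self n.cast_nonneg)
    rw [Chebyshev.psi, Nat.floor_natCast]
    exact Finset.sum_le_sum fun k _ => residueClass_le b k
  · have := eqOn_LFunctionResidueClassAux hb hs
    simp only at this
    rw [this]
    push_cast
    ring

theorem tendsto_sum_mul_vonMangoldt_div_zero {q : ℕ} [NeZero q] {f : ZMod q → ℝ}
    (hf : ∀ b, ¬ IsUnit b → f b = 0) (hsum : ∑ b, f b = 0) :
    Tendsto (fun n : ℕ => (∑ k ∈ Finset.Icc 1 n, f k * Λ k) / n) atTop (𝓝 0) := by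
  have h : ∀ b : ZMod q, Tendsto
      (fun n : ℕ => f b * ((∑ k ∈ Finset.Icc 1 n, residueClass b k) / n)) atTop
      (𝓝 (f b * (q.totient : ℝ)⁻¹)) := fun b => by
    by_cases hb : IsUnit b
    · exact (tendsto_sum_residueClass_div hb).const_mul _
    · simp [hf b hb]
  have h' := tendsto_finsetSum Finset.univ fun b _ => h b
  rw [← Finset.sum_mul, hsum, zero_mul] at h'
  refine h'.congr fun n => ?_
  simp_rw [← mul_div_assoc, ← Finset.sum_div, Finset.mul_sum]
  rw [Finset.sum_comm]
  congr 1
  refine Finset.sum_congr rfl fun k _ => ?_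
  rw [Finset.sum_eq_single (k : ZMod q)]
  · simp [residueClass]
  · intro b _ hb
    simp [residueClass, hb.symm]
  · simp

theorem tendsto_sum_primesLE_div_primeCounting_zero {f : ℕ → ℝ} (hf : ∀ k, |f k| ≤ 1)
    (h : Tendsto (fun n : ℕ => (∑ k ∈ Finset.Icc 1 n, f k * Λ k) / n) atTop (𝓝 0)) :
    Tendsto (fun n : ℕ => (∑ p ∈ n.primesLE, f p) / n.primeCounting) atTop (𝓝 0) := by
  have hψθ : Tendsto (fun n : ℕ => (Chebyshev.psi n - Chebyshev.theta n) / n) atTop (𝓝 0) := by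
    have h1 : (Chebyshev.psi - Chebyshev.theta) =o[atTop] (fun x : ℝ => x) := by
      refine Chebyshev.isBigO_psi_sub_theta_sqrt.trans_isLittleO ?_
      rw [Asymptotics.isLittleO_iff_tendsto' (by
        filter_upwards [eventually_gt_atTop 0] with x hx h0 using absurd h0 hx.ne')]
      refine (Real.tendsto_sqrt_atTop.inv_tendsto_atTop).congr fun x => ?_
      rw [Real.sqrt_div_self', Pi.inv_apply, one_div]
    exact (h1.comp_tendsto tendsto_natCast_atTop_atTop).tendsto_div_nhds_zero
  have hπθ : Tendsto (fun n : ℕ =>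
      (n.primeCounting * Real.log n - Chebyshev.theta n) / n) atTop (𝓝 0) := by
    have h1 : (fun x : ℝ => (⌊x⌋₊.primeCounting - Chebyshev.theta x / Real.log x) * Real.log x)
        =o[atTop] (fun x : ℝ => x) := by
      have h2 := Chebyshev.primeCounting_sub_theta_div_log_isBigO.mul
        (Asymptotics.isBigO_refl Real.log atTop)
      refine h2.trans_isLittleO ?_
      rw [Asymptotics.isLittleO_iff_tendsto' (by
        filter_upwards [eventually_gt_atTop 0] with x hx h0 using absurd h0 hx.ne')]
      refine Real.tendsto_log_atTop.inv_tendsto_atTop.congr' ?_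
      filter_upwards [eventually_gt_atTop 1] with x hx
      have := Real.log_pos hx
      simp only [Pi.inv_apply]
      field_simp
    refine (h1.comp_tendsto tendsto_natCast_atTop_atTop).tendsto_div_nhds_zero.congr' ?_
    filter_upwards [eventually_gt_atTop 1] with n hn
    have := Real.log_pos (by exact_mod_cast hn : (1 : ℝ) < n)
    simp only [Function.comp, Nat.floor_natCast]
    field_simp
  have hlow : ∀ᶠ n : ℕ in atTop,
      Real.log 2 / 2 * n ≤ n.primeCounting * Real.log n := by
    have h1 : Tendsto (fun n : ℕ => Real.log (n + 1) / n) atTop (𝓝 0) := by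
      have h2 := Real.isLittleO_log_id_atTop.comp_tendsto
        (tendsto_atTop_add_const_right _ (1 : ℝ) (tendsto_natCast_atTop_atTop (R := ℝ)))
      suffices h3 : (id ∘ fun n : ℕ => (n : ℝ) + 1) =O[atTop] fun n : ℕ => (n : ℝ) from
        (h2.trans_isBigO h3).tendsto_div_nhds_zero
      refine Asymptotics.IsBigO.of_bound 2 ?_
      filter_upwards [eventually_ge_atTop 1] with n hn
      have : (1 : ℝ) ≤ n := by exact_mod_cast hn
      simp only [Function.comp, id, Real.norm_eq_abs]
      rw [abs_of_pos (by linarith), abs_of_pos (by linarith)]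
      linarith
    filter_upwards [h1.eventually_lt_const (half_pos (Real.log_pos one_lt_two)),
      eventually_gt_atTop 0] with n hn hn0
    have : (0 : ℝ) < n := by exact_mod_cast hn0
    rw [div_lt_iff₀ this] at hn
    linarith [Chebyshev.psi_ge n, Chebyshev.psi_le_primeCounting_mul_log n]
  have hbound := ((h.abs.add hψθ).add hπθ).const_mul (2 / Real.log 2)
  simp only [abs_zero, add_zero, mul_zero] at hbound
  refine squeeze_zero_norm' ?_ hbound
  filter_upwards [hlow, eventually_gt_atTop 1] with n hn hn1
  have hn0 : (0 : ℝ) < n := by exact_mod_cast zero_lt_one.trans hn1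
  have hlog : 0 < Real.log n := Real.log_pos (by exact_mod_cast hn1)
  have hlog2 : 0 < Real.log 2 := Real.log_pos one_lt_two
  have hD : 0 < n.primeCounting * Real.log n := lt_of_lt_of_le (by positivity) hn
  have hsplit : (∑ k ∈ Finset.Icc 1 n, f k * Λ k) =
      ∑ p ∈ n.primesLE, f p * Real.log p + ∑ k ∈ Finset.Icc 1 n with ¬ k.Prime, f k * Λ k := by
    rw [← Finset.sum_filter_add_sum_filter_not _ Nat.Prime]
    congr 1
    have : {k ∈ Finset.Icc 1 n | k.Prime} = n.primesLE := by
      ext p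
      simp only [Finset.mem_filter, Finset.mem_Icc, Nat.mem_primesLE]
      exact ⟨fun h => ⟨h.1.2, h.2⟩, fun h => ⟨⟨h.2.one_le, h.1⟩, h.2⟩⟩
    rw [this]
    exact Finset.sum_congr rfl fun p hp => by
      rw [ArithmeticFunction.vonMangoldt_apply_prime (Nat.prime_of_mem_primesLE hp)]
  have hnp : |∑ k ∈ Finset.Icc 1 n with ¬ k.Prime, f k * Λ k| ≤
      Chebyshev.psi n - Chebyshev.theta n := by
    rw [Chebyshev.psi_sub_theta_eq_sum_not_prime, Nat.floor_natCast]
    refine (Finset.abs_sum_le_sum_abs _ _).trans (Finset.sum_le_sum fun k _ => ?_)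
    rw [abs_mul, abs_of_nonneg ArithmeticFunction.vonMangoldt_nonneg]
    exact mul_le_of_le_one_left ArithmeticFunction.vonMangoldt_nonneg (hf k)
  have hp : |∑ p ∈ n.primesLE, f p * (Real.log n - Real.log p)| ≤
      n.primeCounting * Real.log n - Chebyshev.theta n := by
    rw [Chebyshev.theta_eq_sum_primesLE_log, ← Nat.primesLE_card_eq_primeCounting,
      ← nsmul_eq_mul, ← Finset.sum_const, ← Finset.sum_sub_distrib]
    refine (Finset.abs_sum_le_sum_abs _ _).trans (Finset.sum_le_sum fun p hp => ?_)
    have : 0 ≤ Real.log n - Real.log p := sub_nonneg.2 <| Real.log_le_log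
      (by exact_mod_cast (Nat.prime_of_mem_primesLE hp).pos)
      (by exact_mod_cast Nat.le_of_mem_primesLE hp)
    rw [abs_mul, abs_of_nonneg this]
    exact mul_le_of_le_one_left this (hf p)
  have htot : |∑ p ∈ n.primesLE, f p| * Real.log n ≤
      |∑ k ∈ Finset.Icc 1 n, f k * Λ k| + (Chebyshev.psi n - Chebyshev.theta n) +
        (n.primeCounting * Real.log n - Chebyshev.theta n) := by
    have : (∑ p ∈ n.primesLE, f p) * Real.log n = (∑ k ∈ Finset.Icc 1 n, f k * Λ k)
        - (∑ k ∈ Finset.Icc 1 n with ¬ k.Prime, f k * Λ k)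
        + ∑ p ∈ n.primesLE, f p * (Real.log n - Real.log p) := by
      rw [hsplit, add_sub_cancel_right, ← Finset.sum_add_distrib, Finset.sum_mul]
      exact Finset.sum_congr rfl fun p _ => by ring
    rw [← abs_of_pos hlog, ← abs_mul, this, abs_of_pos hlog]
    refine (abs_add_le _ _).trans (add_le_add ((abs_sub _ _).trans ?_) hp)
    gcongr
  rw [Real.norm_eq_abs, abs_div, Nat.abs_cast, ← mul_div_mul_right _ _ hlog.ne', abs_div,
    Nat.abs_cast, ← add_div, ← add_div, ← mul_div_assoc]
  calc _ ≤ _ := div_le_div_of_nonneg_right htot hD.le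
    _ ≤ _ := div_le_div_of_nonneg_left ((by positivity : (0 : ℝ) ≤ _).trans htot)
      (by positivity) hn
    _ = _ := by field_simp

end

section
open scoped NumberTheorySymbols

/-- The function `k ↦ J(z | k)` on odd numbers, extended by zero to even numbers. -/
noncomputable def oddJacobiSym (z k : ℕ) : ℝ := if Odd k then (J(z | k) : ℝ) else 0

theorem abs_oddJacobiSym_le_one (z k : ℕ) : |oddJacobiSym z k| ≤ 1 := by
  unfold oddJacobiSym
  split_ifs
  · rcases jacobiSym.trichotomy z k with h | h | h <;> simp [h]
  · simp

theorem oddJacobiSym_mul (z k l : ℕ) :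
    oddJacobiSym z (k * l) = oddJacobiSym z k * oddJacobiSym z l := by
  unfold oddJacobiSym
  by_cases hk : Odd k <;> by_cases hl : Odd l <;> simp [Nat.odd_mul, hk, hl]
  have : NeZero k := ⟨hk.pos.ne'⟩
  have : NeZero l := ⟨hl.pos.ne'⟩
  rw [jacobiSym.mul_right]
  push_cast
  rfl

theorem oddJacobiSym_mod (z k : ℕ) : oddJacobiSym z (k % (4 * z)) = oddJacobiSym z k := by
  unfold oddJacobiSym
  have h : Odd (k % (4 * z)) ↔ Odd k := by
    rw [Nat.odd_iff, Nat.odd_iff, Nat.mod_mod_of_dvd _ ⟨2 * z, by ring⟩]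
  by_cases hk : Odd k
  · rw [if_pos (h.2 hk), if_pos hk, jacobiSym.mod_right z hk, Int.natAbs_natCast]
  · rw [if_neg (h.not.2 hk), if_neg hk]

theorem exists_odd_jacobiSym_eq_neg_one {z : ℕ} (hz : Squarefree z) (hz1 : z ≠ 1) :
    ∃ c : ℕ, Odd c ∧ J(z | c) = -1 := by
  by_cases h : ∃ q, q.Prime ∧ q ≠ 2 ∧ q ∣ z
  · obtain ⟨q, hq, hq2, w, rfl⟩ := h
    have := Fact.mk hq
    have hodd : Odd q := hq.odd_of_ne_two hq2
    have hw : w ≠ 0 := by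
      rintro rfl
      simp at hz
    have hqw : q.Coprime w := Nat.coprime_of_squarefree_mul hz
    obtain ⟨u, hu⟩ := FiniteField.exists_nonsquare (F := ZMod q)
      (by rwa [ZMod.ringChar_zmod_n])
    have hcop : q.Coprime (4 * w) :=
      Nat.Coprime.mul_right (by simpa using (Nat.Coprime.pow_right 2 hodd.coprime_two_right)) hqw
    obtain ⟨c, hcu, hc1⟩ := Nat.chineseRemainder hcop u.val 1
    have hc4 : c % 4 = 1 := Nat.ModEq.of_mul_right _ hc1
    have hc : Odd c := by rw [Nat.odd_iff]; omega
    refine ⟨c, hc, ?_⟩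
    have hwc : J(w | c) = 1 := by
      rw [jacobiSym.mod_right w hc, Int.natAbs_natCast, hc1,
        Nat.mod_eq_of_lt (by omega), jacobiSym.one_right]
    rw [Nat.cast_mul, jacobiSym.mul_left, hwc, mul_one,
      ← jacobiSym.quadratic_reciprocity_one_mod_four hc4 hodd, ← jacobiSym.legendreSym.to_jacobiSym,
      legendreSym.eq_neg_one_iff]
    have : ((c : ℤ) : ZMod q) = u := by
      rw [Int.cast_natCast, (ZMod.natCast_eq_natCast_iff _ _ _).2 hcu, ZMod.natCast_zmod_val]
    rwa [this]
  · push Not at h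
    have h2 : z = 2 := by
      have hprod := Nat.prod_primeFactors_of_squarefree hz
      have hsub : z.primeFactors ⊆ {2} := fun q hq => by
        have := h q (Nat.prime_of_mem_primeFactors hq)
        have := Nat.dvd_of_mem_primeFactors hq
        simp only [Finset.mem_singleton]
        tauto
      rcases Finset.subset_singleton_iff.1 hsub with h0 | h0 <;> rw [h0] at hprod
      · exact absurd hprod.symm hz1
      · simpa using hprod.symm
    exact ⟨3, by decide, by subst h2; norm_num⟩

theorem tendsto_sum_oddJacobiSym_div {z : ℕ} (hz : Squarefree z) (hz1 : z ≠ 1) :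
    Tendsto (fun n : ℕ => (∑ p ∈ n.primesLE, oddJacobiSym z p) / n.primeCounting) atTop
      (𝓝 0) := by
  refine tendsto_sum_primesLE_div_primeCounting_zero (abs_oddJacobiSym_le_one z) ?_
  have hz0 := hz.ne_zero
  have : NeZero (4 * z) := ⟨by omega⟩
  let f : ZMod (4 * z) → ℝ := fun b => oddJacobiSym z b.val
  have hfk (k : ℕ) : f k = oddJacobiSym z k := by
    simp only [f, ZMod.val_natCast, oddJacobiSym_mod]
  have hfmul (a b : ZMod (4 * z)) : f (a * b) = f a * f b := by
    simp only [f, ZMod.val_mul, oddJacobiSym_mod, oddJacobiSym_mul]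
  have hf0 (b : ZMod (4 * z)) (hb : ¬ IsUnit b) : f b = 0 := by
    simp only [f, oddJacobiSym]
    split_ifs with hodd
    · have : NeZero b.val := ⟨hodd.pos.ne'⟩
      rw [Int.cast_eq_zero, jacobiSym.eq_zero_iff_not_coprime]
      contrapose! hb
      rw [← ZMod.natCast_zmod_val b, ZMod.isUnit_iff_coprime]
      rw [Int.gcd_natCast_natCast] at hb
      refine Nat.Coprime.mul_right ?_ (Nat.Coprime.symm hb)
      simpa using (Nat.Coprime.pow_right 2 hodd.coprime_two_right)
    · rfl
  have hsum : ∑ b, f b = 0 := by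
    obtain ⟨c, hc, hc1⟩ := exists_odd_jacobiSym_eq_neg_one hz hz1
    have hfc : f c = -1 := by simp [hfk, oddJacobiSym, hc, hc1]
    have hcu : IsUnit (c : ZMod (4 * z)) := by
      by_contra h
      simp [hf0 _ h] at hfc
    have := Fintype.sum_equiv hcu.unit.mulLeft (fun b => f (c * b)) f fun b => by simp
    simp_rw [hfmul, ← Finset.mul_sum, hfc] at this
    linarith
  simpa only [hfk] using tendsto_sum_mul_vonMangoldt_div_zero hf0 hsum

end

section
open scoped NumberTheorySymbols

theorem tendsto_sum_primesLE_div_of_eq_off_finset {f g : ℕ → ℝ} (E : Finset ℕ)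
    (hfg : ∀ p, p.Prime → p ∉ E → f p = g p) {l : ℝ}
    (hg : Tendsto (fun n : ℕ => (∑ p ∈ n.primesLE, g p) / n.primeCounting) atTop (𝓝 l)) :
    Tendsto (fun n : ℕ => (∑ p ∈ n.primesLE, f p) / n.primeCounting) atTop (𝓝 l) := by
  have hπ : Tendsto (fun n : ℕ => (n.primeCounting : ℝ)) atTop atTop :=
    tendsto_natCast_atTop_atTop.comp Nat.tendsto_primeCounting
  have h0 : Tendsto (fun n : ℕ => (∑ p ∈ n.primesLE, (f p - g p)) / n.primeCounting) atTop
      (𝓝 0) := by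
    refine squeeze_zero_norm (fun n => ?_)
      ((tendsto_const_nhds (x := ∑ p ∈ E, |f p - g p|)).div_atTop hπ)
    rw [Real.norm_eq_abs, abs_div, Nat.abs_cast]
    gcongr
    refine (Finset.abs_sum_le_sum_abs _ _).trans ?_
    rw [← Finset.sum_filter_of_ne (p := (· ∈ E))]
    · refine Finset.sum_le_sum_of_subset_of_nonneg (fun p hp => (Finset.mem_filter.1 hp).2)
        fun _ _ _ => abs_nonneg _
    · intro p hp hne
      by_contra h
      exact hne (by simp [hfg p (Nat.prime_of_mem_primesLE hp) h])
  have := hg.add h0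
  rw [add_zero] at this
  refine this.congr fun n => ?_
  rw [← add_div, ← Finset.sum_add_distrib]
  simp

theorem hasPrimeDensity_iff {P : Set ℕ} (hP : ∀ p ∈ P, p.Prime) {δ : ℝ} :
    HasPrimeDensity P δ ↔ Tendsto (fun n : ℕ =>
      (∑ p ∈ n.primesLE, if p ∈ P then (1 : ℝ) else 0) / n.primeCounting) atTop (𝓝 δ) := by
  unfold HasPrimeDensity
  refine tendsto_congr fun n => ?_
  congr 2
  · have : {p ∈ P | p ≤ n} = ({p ∈ n.primesLE | p ∈ P} : Finset ℕ) := by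
      ext p
      simp only [Set.mem_ofPred_eq, Finset.coe_filter, Nat.mem_primesLE]
      exact ⟨fun h => ⟨⟨h.2, hP p h.1⟩, h.1⟩, fun h => ⟨h.2, h.1.1⟩⟩
    rw [this, Set.ncard_coe_finset, Finset.sum_boole]
  · have : {p | p.Prime ∧ p ≤ n} = (n.primesLE : Set ℕ) := by
      ext p
      simp [Nat.mem_primesLE, and_comm]
    rw [this, Set.ncard_coe_finset, Nat.primesLE_card_eq_primeCounting]

theorem jacobiSym_prod_left {ι : Type*} (s : Finset ι) (f : ι → ℤ) (p : ℕ) :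
    J(∏ i ∈ s, f i | p) = ∏ i ∈ s, J(f i | p) := by
  induction s using Finset.induction_on with
  | empty => simp [jacobiSym.one_left]
  | insert i s hi ih => rw [Finset.prod_insert hi, Finset.prod_insert hi, jacobiSym.mul_left, ih]

theorem Squarefree.jacobiSym_eq_prod {z : ℕ} (hz : Squarefree z) (p : ℕ) :
    J(z | p) = ∏ q ∈ z.primeFactors, J(q | p) := by
  rw [← jacobiSym_prod_left, ← Nat.cast_prod, Nat.prod_primeFactors_of_squarefree hz]

/-- The character of `ι → ZMod 2` whose value on the `i`-th basis vector is `s i`. -/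
def signChar {ι : Type*} [Fintype ι] (s : ι → ℤ) (w : ι → ZMod 2) : ℤ :=
  ∏ i, if w i = 0 then 1 else s i

section signChar
variable {ι : Type*} [Fintype ι]

theorem signChar_zero (s : ι → ℤ) : signChar s 0 = 1 := by simp [signChar]

theorem signChar_add {s : ι → ℤ} (hs : ∀ i, s i ^ 2 = 1) (v w : ι → ZMod 2) :
    signChar s (v + w) = signChar s v * signChar s w := by
  unfold signChar
  rw [← Finset.prod_mul_distrib]
  refine Finset.prod_congr rfl fun i _ => ?_
  rw [Pi.add_apply]
  have h2 : ∀ x : ZMod 2, x = 0 ∨ x = 1 := by decide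
  have h11 : (1 : ZMod 2) + 1 = 0 := by decide
  rcases h2 (v i) with h | h <;> rcases h2 (w i) with h' | h' <;> simp [h, h', h11, ← sq, hs]

theorem signChar_mul (s t : ι → ℤ) (w : ι → ZMod 2) :
    signChar (s * t) w = signChar s w * signChar t w := by
  unfold signChar
  rw [← Finset.prod_mul_distrib]
  refine Finset.prod_congr rfl fun i _ => ?_
  split_ifs <;> simp

theorem signChar_eq_one_on_span {s : ι → ℤ} (hs : ∀ i, s i ^ 2 = 1) {T : Set (ι → ZMod 2)}
    (hT : ∀ w ∈ T, signChar s w = 1) :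
    ∀ w ∈ Submodule.span (ZMod 2) T, signChar s w = 1 := by
  intro w hw
  induction hw using Submodule.span_induction with
  | mem w h => exact hT w h
  | zero => exact signChar_zero s
  | add v w _ _ hv hw => rw [signChar_add hs, hv, hw, one_mul]
  | smul c w _ hw =>
    have h2 : ∀ x : ZMod 2, x = 0 ∨ x = 1 := by decide
    rcases h2 c with rfl | rfl
    · rw [zero_smul, signChar_zero]
    · rw [one_smul, hw]

theorem sum_signChar_span {s : ι → ℤ} (hs : ∀ i, s i ^ 2 = 1) (T : Set (ι → ZMod 2))
    [Fintype (Submodule.span (ZMod 2) T)] :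
    ∑ w : Submodule.span (ZMod 2) T, signChar s w =
      if ∀ w ∈ T, signChar s w = 1 then
        (2 : ℤ) ^ Module.finrank (ZMod 2) (Submodule.span (ZMod 2) T) else 0 := by
  split_ifs with h
  · rw [Finset.sum_congr rfl fun (w : Submodule.span (ZMod 2) T) _ => signChar_eq_one_on_span hs h w w.2, Finset.sum_const,
      Finset.card_univ, Module.card_eq_pow_finrank (K := ZMod 2), ZMod.card]
    simp
  · push Not at h
    obtain ⟨w₀, hw₀, hne⟩ := h
    have := Fintype.sum_equiv
      (Equiv.addLeft (⟨w₀, Submodule.subset_span hw₀⟩ : Submodule.span (ZMod 2) T))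
      (fun w => signChar s (w₀ + w)) (fun w => signChar s w) fun w => by simp
    simp_rw [signChar_add hs, ← Finset.mul_sum] at this
    by_contra h0
    exact hne (mul_right_cancel₀ h0 (by rw [this, one_mul]))

theorem jacobiSym_prod_eq_signChar (e : ι → ℕ) (w : ι → ZMod 2) (p : ℕ) :
    J((∏ i, if w i = 0 then 1 else e i : ℕ) | p) = signChar (fun i => J(e i | p)) w := by
  rw [Nat.cast_prod, jacobiSym_prod_left]
  refine Finset.prod_congr rfl fun i _ => ?_
  split_ifs <;> simp [jacobiSym.one_left]

theorem squarefree_prod_ite {e : ι → ℕ} (he : ∀ i, (e i).Prime) (hinj : e.Injective)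
    (w : ι → ZMod 2) : Squarefree (∏ i, if w i = 0 then 1 else e i) := by
  refine Finset.squarefree_prod_of_pairwise_isCoprime (fun i _ j _ hij => ?_) fun i _ => ?_
  · rw [Function.onFun, ← Nat.coprime_iff_isRelPrime]
    split_ifs
    any_goals simp
    exact (Nat.coprime_primes (he i) (he j)).2 (hinj.ne hij)
  · split_ifs
    · exact squarefree_one
    · exact (he i).squarefree

theorem prod_ite_ne_one {e : ι → ℕ} (he : ∀ i, (e i).Prime) {w : ι → ZMod 2} (hw : w ≠ 0) :
    (∏ i, if w i = 0 then 1 else e i) ≠ 1 := by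
  obtain ⟨i, hi⟩ := Function.ne_iff.1 hw
  intro h
  have := Finset.prod_eq_one_iff.1 h i (Finset.mem_univ i)
  rw [if_neg (by simpa using hi)] at this
  exact (he i).ne_one this

end signChar

theorem signChar_indVec {n : ℕ} (A : Finset ℕ) (h : A.card = n) {B : Finset ℕ} (hB : B ⊆ A)
    (s : ℕ → ℤ) :
    signChar (fun i => s (A.orderIsoOfFin h i)) (indVec A h B) = ∏ q ∈ B, s q := by
  unfold signChar indVec
  have := (A.orderIsoOfFin h).toEquiv.prod_comp fun q : A => if (q : ℕ) ∈ B then s q else 1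
  rw [Finset.prod_coe_sort A fun q => if q ∈ B then s q else 1, Finset.prod_ite_mem,
    Finset.inter_eq_right.2 hB] at this
  rw [← this]
  refine Finset.prod_congr rfl fun i _ => ?_
  simp only [RelIso.coe_fn_toEquiv]
  split_ifs <;> simp_all

theorem prod_ite_mem_neg_one (N B : Finset ℕ) :
    ∏ q ∈ B, (if q ∈ N then (-1 : ℤ) else 1) = (-1) ^ (N ∩ B).card := by
  rw [Finset.prod_ite, Finset.prod_const, Finset.prod_const_one, mul_one,
    Finset.filter_mem_eq_inter, Finset.inter_comm]

end

end

/-- formula (3.6) of the paper. With `𝐒 = {S_1, …, S_m}` nonempty finite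
sets of squarefree positive integers, `Π` the set of primes dividing some element,
`n = |Π|`, `d` the dimension of the span of `v((⋃ᵢ 𝒮ᵢ) \ {∅})` in `F^n`,
`M_0 = {i : 1 ∉ S_i}`, `M_1 = {i : 1 ∈ S_i}`, the density of
`(⋂_{i∈M₁} X_i⁺) ∩ (⋂_{i∈M₀} X_i⁻)` — the set of allowable (odd) primes `p` with `χ_p ≡ 1`
on every `S_i`, `i ∈ M₁`, and `χ_p ≡ −1` on every `S_i`, `i ∈ M₀` — is `2^(−d)` if
`𝒩(M₀, M₁) ≠ ∅`, and `0` otherwise. -/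
theorem density_all_plus_on_M1_minus_on_M0
    (m : ℕ) (hm : 0 < m) (S : Fin m → Finset ℕ) (hSne : ∀ i, (S i).Nonempty)
    (hsf : ∀ i, ∀ z ∈ S i, Squarefree z)
    (P0 : Finset ℕ) (hP0 : P0 = (Finset.univ.biUnion S).biUnion Nat.primeFactors)
    (n : ℕ) (hn : P0.card = n)
    (d : ℕ)
    (hd : d = Module.finrank (ZMod 2) (Submodule.span (ZMod 2)
      (indVec P0 hn '' (↑((Finset.univ.biUnion fun i => (S i).image Nat.primeFactors) \ {∅})
        : Set (Finset ℕ)))))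
    (M0 M1 : Finset (Fin m))
    (hM0 : M0 = Finset.univ.filter (fun i => 1 ∉ S i))
    (hM1 : M1 = Finset.univ.filter (fun i => 1 ∈ S i))
    (X : Set ℕ)
    (hX : X = {p | p.Prime ∧ p ≠ 2 ∧ (∀ i, ∀ z ∈ S i, ¬ p ∣ z) ∧
      (∀ i ∈ M1, ∀ z ∈ S i, jacobiSym (z : ℤ) p = 1) ∧
      (∀ i ∈ M0, ∀ z ∈ S i, jacobiSym (z : ℤ) p = -1)}) :
    ((NSet S P0 M1 M0).Nonempty → HasPrimeDensity X ((2 : ℝ) ^ (-(d : ℤ)))) ∧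
    (¬ (NSet S P0 M1 M0).Nonempty → HasPrimeDensity X 0) := by
  have hP0prime : ∀ q ∈ P0, q.Prime := fun q hq => by
    rw [hP0, Finset.mem_biUnion] at hq
    obtain ⟨z, -, hz⟩ := hq
    exact Nat.prime_of_mem_primeFactors hz
  have hsub : ∀ i, ∀ z ∈ S i, z.primeFactors ⊆ P0 := fun i z hz => by
    rw [hP0]
    exact Finset.subset_biUnion_of_mem _ (Finset.mem_biUnion.2 ⟨i, Finset.mem_univ i, hz⟩)
  have hallow : ∀ p : ℕ, p.Prime → ((∀ i, ∀ z ∈ S i, ¬ p ∣ z) ↔ p ∉ P0) := fun p hp => by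
    rw [hP0]
    simp only [Finset.mem_biUnion, Finset.mem_univ, true_and, Nat.mem_primeFactors]
    constructor
    · rintro h ⟨z, ⟨i, hi⟩, -, hpz, -⟩
      exact h i z hi hpz
    · exact fun h i z hz hpz => h ⟨z, ⟨i, hz⟩, hp, hpz, (hsf i z hz).ne_zero⟩
  have hsq : ∀ p : ℕ, p.Prime → p ∉ P0 → ∀ q ∈ P0, jacobiSym q p ^ 2 = 1 := fun p hp hpP q hq =>
    jacobiSym.sq_one <| by
      rw [Int.gcd_natCast_natCast]
      exact (Nat.coprime_primes (hP0prime q hq) hp).2 fun h => hpP (h ▸ hq)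
  have hM : ∀ i, i ∈ M1 ∨ i ∈ M0 := fun i => by
    rw [hM0, hM1]
    simp [em]
  have hXprime : ∀ p ∈ X, p.Prime := fun p hp => by
    rw [hX] at hp
    exact hp.1
  refine ⟨fun ⟨N, hN⟩ => ?_, fun hN => ?_⟩
  · simp only [NSet, Finset.mem_filter] at hN
    obtain ⟨-, hN1, hN0⟩ := hN
    set T := indVec P0 hn '' (↑((Finset.univ.biUnion fun i => (S i).image Nat.primeFactors) \ {∅})
        : Set (Finset ℕ))
    let e : Fin n → ℕ := fun i => P0.orderIsoOfFin hn i
    have heP : ∀ i, e i ∈ P0 := fun i => (P0.orderIsoOfFin hn i).2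
    have hinj : e.Injective := Subtype.val_injective.comp (P0.orderIsoOfFin hn).injective
    let σ : ℕ → ℤ := fun q => if q ∈ N then -1 else 1
    have hσ : ∀ q, σ q ^ 2 = 1 := fun q => by
      simp only [σ]
      split_ifs <;> norm_num
    let r : (Fin n → ZMod 2) → ℕ := fun w => ∏ i, if w i = 0 then 1 else e i
    have hmem : ∀ p : ℕ, p.Prime → p ∉ insert 2 P0 →
        (p ∈ X ↔ ∀ w ∈ T, signChar (fun i => σ (e i) * jacobiSym (e i) p) w = 1) := by
      intro p hp hpE
      rw [Finset.mem_insert, not_or] at hpE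
      have hval : ∀ i, ∀ z ∈ S i,
          signChar (fun i => σ (e i) * jacobiSym (e i) p) (indVec P0 hn z.primeFactors) =
            (-1) ^ (N ∩ z.primeFactors).card * jacobiSym z p := fun i z hz => by
        rw [signChar_indVec P0 hn (hsub i z hz) fun q => σ q * jacobiSym q p,
          Finset.prod_mul_distrib, prod_ite_mem_neg_one, (hsf i z hz).jacobiSym_eq_prod]
      have hTX : (∀ w ∈ T, signChar (fun i => σ (e i) * jacobiSym (e i) p) w = 1) ↔
          ∀ i, ∀ z ∈ S i, (-1) ^ (N ∩ z.primeFactors).card * jacobiSym z p = 1 := by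
        constructor
        · intro h i z hz
          by_cases hz0 : z.primeFactors = ∅
          · rw [(hsf i z hz).jacobiSym_eq_prod, hz0]
            simp
          · rw [← hval i z hz]
            refine h _ ⟨_, ?_, rfl⟩
            simp only [Finset.coe_sdiff, Set.mem_sdiff, Finset.mem_coe, Finset.mem_biUnion,
              Finset.mem_univ, true_and, Finset.mem_image, Finset.mem_singleton]
            exact ⟨⟨i, z, hz, rfl⟩, hz0⟩
        · rintro h w ⟨B, hB, rfl⟩
          simp only [Finset.coe_sdiff, Set.mem_sdiff, Finset.mem_coe, Finset.mem_biUnion,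
            Finset.mem_univ, true_and, Finset.mem_image] at hB
          obtain ⟨⟨i, z, hz, rfl⟩, -⟩ := hB
          rw [hval i z hz, h i z hz]
      rw [hTX, hX]
      constructor
      · rintro ⟨-, -, -, h1, h0⟩ i z hz
        rcases hM i with hi | hi
        · rw [h1 i hi z hz, (hN1 i hi z hz).neg_one_pow, one_mul]
        · rw [h0 i hi z hz, (hN0 i hi z hz).neg_one_pow]
          norm_num
      · refine fun h => ⟨hp, hpE.1, (hallow p hp).2 hpE.2, fun i hi z hz => ?_, fun i hi z hz => ?_⟩
        · have := h i z hz
          rwa [(hN1 i hi z hz).neg_one_pow, one_mul] at this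
        · have := h i z hz
          rw [(hN0 i hi z hz).neg_one_pow] at this
          linarith
    rw [hasPrimeDensity_iff hXprime]
    refine tendsto_sum_primesLE_div_of_eq_off_finset (insert 2 P0)
      (g := fun p => 2 ^ (-(d : ℤ)) * ∑ w : Submodule.span (ZMod 2) T,
        (signChar (σ ∘ e) w : ℝ) * oddJacobiSym (r w) p) (fun p hp hpE => ?_) ?_
    · have hp2 : p ≠ 2 := fun h => hpE (by simp [h])
      have hpP : p ∉ P0 := fun h => hpE (by simp [h])
      have key := sum_signChar_span (s := fun i => σ (e i) * jacobiSym (e i) p)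
        (fun i => by rw [mul_pow, hσ, hsq p hp hpP _ (heP i), one_mul]) T
      rw [← hd] at key
      have hterm : ∀ w : Fin n → ZMod 2, (signChar (σ ∘ e) w : ℝ) * oddJacobiSym (r w) p =
          (signChar (fun i => σ (e i) * jacobiSym (e i) p) w : ℤ) := fun w => by
        have := signChar_mul (σ ∘ e) (fun i => jacobiSym (e i) p) w
        rw [← jacobiSym_prod_eq_signChar] at this
        rw [oddJacobiSym, if_pos (hp.odd_of_ne_two hp2), ← Int.cast_mul, ← this]
        rfl
      simp only [hterm]
      rw [← Int.cast_sum, key]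
      simp only [← hmem p hp hpE]
      split_ifs <;> simp
    · have hterm : ∀ w : Submodule.span (ZMod 2) T, Filter.Tendsto
          (fun x : ℕ => (∑ p ∈ x.primesLE, oddJacobiSym (r w) p) / x.primeCounting) Filter.atTop
          (nhds (if w = 0 then 1 else 0)) := fun w => by
        split_ifs with hw
        · refine tendsto_sum_primesLE_div_of_eq_off_finset {2} (g := fun _ => 1)
            (fun p hp hp2 => ?_) ?_
          · rw [oddJacobiSym, if_pos (hp.odd_of_ne_two (by simpa using hp2))]
            simp [r, hw, jacobiSym.one_left]
          · refine tendsto_const_nhds.congr' ?_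
            filter_upwards [Nat.tendsto_primeCounting.eventually_gt_atTop 0] with x hx
            simp [Nat.primesLE_card_eq_primeCounting, hx.ne']
        · exact tendsto_sum_oddJacobiSym_div
            (squarefree_prod_ite (fun i => hP0prime _ (heP i)) hinj w)
            (prod_ite_ne_one (fun i => hP0prime _ (heP i)) (by simpa using hw))
      have := (tendsto_finsetSum Finset.univ fun w _ =>
        (hterm w).const_mul (signChar (σ ∘ e) (w : Fin n → ZMod 2) : ℝ)).const_mul
          ((2 : ℝ) ^ (-(d : ℤ)))
      simp only [mul_ite, mul_one, mul_zero, Finset.sum_ite_eq', Finset.mem_univ, if_true,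
        ZeroMemClass.coe_zero, signChar_zero, Int.cast_one] at this
      refine this.congr fun x => ?_
      rw [← Finset.mul_sum, Finset.sum_comm, mul_div_assoc, Finset.sum_div]
      simp only [← Finset.mul_sum, mul_div_assoc]
  · have hempty : X = ∅ := by
      refine Set.eq_empty_of_forall_notMem fun p hp => hN ?_
      have hpX := hp
      rw [hX] at hpX
      obtain ⟨hpp, -, hpS, h1, h0⟩ := hpX
      have hpP := (hallow p hpp).1 hpS
      have hval : ∀ i, ∀ z ∈ S i,
          (-1) ^ (({q ∈ P0 | jacobiSym q p = -1} : Finset ℕ) ∩ z.primeFactors).card = jacobiSym z p := by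
        intro i z hz
        rw [(hsf i z hz).jacobiSym_eq_prod, ← prod_ite_mem_neg_one]
        refine Finset.prod_congr rfl fun q hq => ?_
        have hqP := hsub i z hz hq
        rcases sq_eq_one_iff.1 (hsq p hpp hpP q hqP) with h | h <;> simp [h, hqP]
      refine ⟨{q ∈ P0 | jacobiSym q p = -1}, ?_⟩
      simp only [NSet, Finset.mem_filter, Finset.mem_powerset]
      refine ⟨Finset.filter_subset _ _, fun i hi z hz => ?_, fun i hi z hz => ?_⟩
      · exact (neg_one_pow_eq_one_iff_even (R := ℤ) (by decide)).1 ((hval i z hz).trans (h1 i hi z hz))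
      · exact (neg_one_pow_eq_neg_one_iff_odd (R := ℤ) (by decide)).1 ((hval i z hz).trans (h0 i hi z hz))
    rw [hempty, hasPrimeDensity_iff (by simp)]
    simp
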